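/- For every k′ ≥ k ≥ 1, every m′ ≥ m ≥ 1, and every choice of m ranks 1 ≤ r₁ < r₂ < ⋯ < r_m ≤ m′, the Hart–Sharir sequence S_{k′}(m′) structurally contains S_k(m) by a copy in which, for each 1 ≤ j ≤ m, every symbol occupying position j of its special block in S_k(m) is represented by a symbol of S_{k′}(m′) of rank r_j. -/

import Mathlib

/-! ### Sequences with special blocks, encoded as token lists

A sequence with special blocks is encoded as a list of tokens: `Tok.sym a` is an
occurrence of the symbol `a`, and `Tok.op` / `Tok.cl` are the opening and closing
parentheses delimiting the special blocks. -/

/-- Tokens of a symbol sequence with special blocks. -/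
inductive Tok : Type where
  | sym : ℕ → Tok
  | op : Tok
  | cl : Tok
deriving DecidableEq, Repr

/-- Tokens of an endpoint sequence with special blocks: `L a` / `R a` are the
left/right endpoint letters of the symbol `a`, and `op`/`cl` delimit blocks. -/
inductive ETok : Type where
  | L : ℕ → ETok
  | R : ℕ → ETok
  | op : ETok
  | cl : ETok
deriving DecidableEq, Repr

/-- Fresh relabeling of the symbols of the `i`-th local copy. -/
def loc (i a : ℕ) : ℕ := 2 * Nat.pair i a

/-- Relabeling of the global symbols. -/
def glob (a : ℕ) : ℕ := 2 * a + 1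

/-- The underlying sequence of symbols of a token list (parentheses dropped). -/
def symsOf : List Tok → List ℕ
  | [] => []
  | Tok.sym a :: r => a :: symsOf r
  | _ :: r => symsOf r

/-- Read a special block: the symbols up to (and excluding) the next closing
parenthesis, together with the remainder of the list after that parenthesis. -/
def takeBlock : List Tok → List ℕ × List Tok
  | [] => ([], [])
  | Tok.cl :: r => ([], r)
  | Tok.sym a :: r => ((takeBlock r).1.cons a, (takeBlock r).2)
  | Tok.op :: r => takeBlock r

theorem takeBlock_len : ∀ l : List Tok, (takeBlock l).2.length ≤ l.length := by
  intro l
  induction l with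
  | nil => simp [takeBlock]
  | cons t r ih => cases t <;> simp [takeBlock] <;> omega

/-- Auxiliary function for the shuffle `A • B`: traverse the `i`-th fresh copy of
`A` (relabeling its symbols by `loc i`), inserting the next global symbol of the
list `ins` (relabeled by `glob`) at the end of each special block and duplicating
the previously last symbol of that block immediately after the block.  The third
argument remembers the (relabeled) last symbol seen. -/
def copyIns (i : ℕ) : List Tok → List ℕ → Option ℕ → List Tok
  | [], _, _ => []
  | Tok.sym a :: r, ins, _ => Tok.sym (loc i a) :: copyIns i r ins (some (loc i a))
  | Tok.op :: r, ins, p => Tok.op :: copyIns i r ins p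
  | Tok.cl :: r, b :: ins, some q =>
      Tok.sym (glob b) :: Tok.cl :: Tok.sym q :: copyIns i r ins (some q)
  | Tok.cl :: r, ins, p => Tok.cl :: copyIns i r ins p

/-- The modified copy `Aᵢ'` of `A` used in the shuffle `A • B`: the symbols of the
`i`-th special block `blk` of `B` are inserted into the special blocks of the copy,
and another copy of the last symbol of `blk` is appended at the very end. -/
def copyA (i : ℕ) (A : List Tok) (blk : List ℕ) : List Tok :=
  copyIns i A blk none ++ (blk.getLast?.elim [] fun a => [Tok.sym (glob a)])

/-- Auxiliary function for the shuffle: traverse `B` (relabeling its symbols by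
`glob`), replacing its `i`-th special block by the modified `i`-th copy of `A`. -/
def bulletAux (A : List Tok) : ℕ → List Tok → List Tok
  | _, [] => []
  | i, Tok.op :: r => copyA i A (takeBlock r).1 ++ bulletAux A (i + 1) (takeBlock r).2
  | i, Tok.sym a :: r => Tok.sym (glob a) :: bulletAux A i r
  | i, Tok.cl :: r => Tok.cl :: bulletAux A i r
termination_by _ l => l.length
decreasing_by
  · exact Nat.lt_succ_of_le (takeBlock_len r)
  · exact Nat.lt_succ_self _
  · exact Nat.lt_succ_self _

/-- The shuffle `A • B` of two sequences with special blocks. -/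
def bullet (A B : List Tok) : List Tok := bulletAux A 0 B

/-- Split each special block of length 2 into two special blocks of length 1. -/
def split2 : List Tok → List Tok
  | Tok.op :: Tok.sym a :: Tok.sym b :: Tok.cl :: r =>
      Tok.op :: Tok.sym a :: Tok.cl :: Tok.op :: Tok.sym b :: Tok.cl :: split2 r
  | t :: r => t :: split2 r
  | [] => []

/-- The Hart–Sharir sequence `S₁(m) = (1 2 ⋯ m) (m−1) ⋯ 2 1 2 ⋯ m`,
with a single special block `(1 2 ⋯ m)`. -/
def S1 (m : ℕ) : List Tok :=
  Tok.op :: ((List.range' 1 m).map Tok.sym) ++ Tok.cl ::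
    (((List.range' 1 (m - 1)).reverse.map Tok.sym) ++ ((List.range' 2 (m - 1)).map Tok.sym))

/-- The number of special blocks of a token sequence. -/
def numBlocks (S : List Tok) : ℕ := S.count Tok.op

/-- The Hart–Sharir sequences `S_k(m)`, defined by double recursion:
`S₁(m)` is the `N`-shaped sequence above; for `k ≥ 2`, `S_k(1)` is `S_{k−1}(2)` with
each special block of length 2 split into two special blocks of length 1; and for
`k, m ≥ 2`, `S_k(m) = S_k(m−1) • S_{k−1}(N)` where `N` is the number of special
blocks of `S_k(m−1)`.  (The value for `k = 0` or `m = 0` is junk.) -/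
def HS : ℕ → ℕ → List Tok
  | 0, _ => []
  | 1, m => S1 m
  | _ + 2, 0 => []
  | k + 2, 1 => split2 (HS (k + 1) 2)
  | k + 2, m + 2 => bullet (HS (k + 2) (m + 1)) (HS (k + 1) (numBlocks (HS (k + 2) (m + 1))))
termination_by k m => (k, m)



/-- The list of special blocks of a token sequence (each block as its list of symbols). -/
def blocksOf : List Tok → List (List ℕ)
  | [] => []
  | Tok.op :: r => (takeBlock r).1 :: blocksOf (takeBlock r).2
  | _ :: r => blocksOf r
termination_by l => l.length
decreasing_by
  · exact Nat.lt_succ_of_le (takeBlock_len r)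
  · exact Nat.lt_succ_self _

/-- The rank of a symbol: the position (counting from 1) that its first occurrence
occupies within its special block (`0` if the symbol lies in no special block). -/
def rankOf (S : List Tok) (a : ℕ) : ℕ :=
  match (blocksOf S).find? (fun b => decide (a ∈ b)) with
  | some b => b.idxOf a + 1
  | none => 0

/-- Two symbols have their first occurrences in the same special block. -/
def SameBlock (S : List Tok) (a b : ℕ) : Prop :=
  ∃ blk ∈ blocksOf S, a ∈ blk ∧ b ∈ blk

/-- The symbol `a` is left-clamped in the sequence `s`: `s` contains the
subsequence `b a b a`, where `b` is the symbol immediately preceding the first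
occurrence of `a` in `s`. -/
def LeftClamped (s : List ℕ) (a : ℕ) : Prop :=
  ∃ (u v : List ℕ) (b : ℕ), s = u ++ b :: a :: v ∧ a ∉ u ∧ b ≠ a ∧
    [b, a, b, a].Sublist s

/-- The symbol `a` is right-clamped in the sequence `s`: `s` contains the
subsequence `a b a b`, where `b` is the symbol immediately following the last
occurrence of `a` in `s`. -/
def RightClamped (s : List ℕ) (a : ℕ) : Prop :=
  ∃ (u v : List ℕ) (b : ℕ), s = u ++ a :: b :: v ∧ a ∉ v ∧ b ≠ a ∧
    [a, b, a, b].Sublist s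

/-- Auxiliary function for the endpoint sequence: the first argument collects the
symbols already seen.  The first occurrence of each symbol becomes an `L` letter,
its last occurrence becomes an `R` letter, all other occurrences are deleted, and
parentheses are kept. -/
def EAux : List ℕ → List Tok → List ETok
  | _, [] => []
  | seen, Tok.op :: r => ETok.op :: EAux seen r
  | seen, Tok.cl :: r => ETok.cl :: EAux seen r
  | seen, Tok.sym a :: r =>
      if a ∈ seen then
        if a ∈ symsOf r then EAux seen r else ETok.R a :: EAux seen r
      else ETok.L a :: EAux (a :: seen) r

/-- The endpoint sequence `E(S)` of a sequence with special blocks. -/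
def Efun (S : List Tok) : List ETok := EAux [] S

/-- Read a special block of an endpoint sequence: the labels of the `L` letters up
to the next closing parenthesis, and the remainder of the list after it. -/
def takeBlockE : List ETok → List ℕ × List ETok
  | [] => ([], [])
  | ETok.cl :: r => ([], r)
  | ETok.L a :: r => ((takeBlockE r).1.cons a, (takeBlockE r).2)
  | _ :: r => takeBlockE r

theorem takeBlockE_len : ∀ l : List ETok, (takeBlockE l).2.length ≤ l.length := by
  intro l
  induction l with
  | nil => simp [takeBlockE]
  | cons t r ih => cases t <;> simp [takeBlockE] <;> omega

/-- Auxiliary function for the endpoint shuffle `A ∘ B`: traverse the `i`-th fresh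
copy of `A` (relabeling by `loc i`), inserting the next left-endpoint letter of the
list `ins` (relabeled by `glob`) at the end of each special block. -/
def ecopyIns (i : ℕ) : List ETok → List ℕ → List ETok
  | [], _ => []
  | ETok.L a :: r, ins => ETok.L (loc i a) :: ecopyIns i r ins
  | ETok.R a :: r, ins => ETok.R (loc i a) :: ecopyIns i r ins
  | ETok.op :: r, ins => ETok.op :: ecopyIns i r ins
  | ETok.cl :: r, b :: ins => ETok.L (glob b) :: ETok.cl :: ecopyIns i r ins
  | ETok.cl :: r, [] => ETok.cl :: ecopyIns i r []

/-- Auxiliary function for the endpoint shuffle: traverse `B` (relabeling by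
`glob`), replacing its `i`-th special block by the `i`-th modified copy of `A`. -/
def eshufAux (A : List ETok) : ℕ → List ETok → List ETok
  | _, [] => []
  | i, ETok.op :: r => ecopyIns i A (takeBlockE r).1 ++ eshufAux A (i + 1) (takeBlockE r).2
  | i, ETok.L a :: r => ETok.L (glob a) :: eshufAux A i r
  | i, ETok.R a :: r => ETok.R (glob a) :: eshufAux A i r
  | i, ETok.cl :: r => ETok.cl :: eshufAux A i r
termination_by _ l => l.length
decreasing_by
  · exact Nat.lt_succ_of_le (takeBlockE_len r)
  · exact Nat.lt_succ_self _
  · exact Nat.lt_succ_self _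
  · exact Nat.lt_succ_self _

/-- The endpoint shuffle `A ∘ B` of two endpoint sequences with special blocks. -/
def eshuffle (A B : List ETok) : List ETok := eshufAux A 0 B

/-- The token list is a well-formed sequence with special blocks: a concatenation
of symbols and of parenthesized blocks consisting only of symbols. -/
inductive Blocked : List Tok → Prop
  | nil : Blocked []
  | sym (a : ℕ) {l : List Tok} : Blocked l → Blocked (Tok.sym a :: l)
  | blk (b : List ℕ) {l : List Tok} :
      Blocked l → Blocked (Tok.op :: b.map Tok.sym ++ Tok.cl :: l)

/-- The special blocks of `S` contain only first occurrences of symbols, and every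
symbol of `S` makes its first occurrence inside a special block. -/
def FirstOccBlocks (S : List Tok) : Prop :=
  (∀ (u b v : List Tok), S = u ++ Tok.op :: b ++ Tok.cl :: v →
      ∀ a : ℕ, Tok.sym a ∈ b → a ∉ symsOf u ∧ (symsOf b).count a = 1) ∧
  (∀ a ∈ symsOf S, ∃ (u b v : List Tok),
      S = u ++ Tok.op :: b ++ Tok.cl :: v ∧ Tok.sym a ∈ b ∧ a ∉ symsOf u)

namespace HartSharir

/-! ### Compressed sequences

In every Hart–Sharir sequence a special block `(a₁ ⋯ aₘ)` is immediately followed by the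
descending run `aₘ₋₁ ⋯ a₁`. A compressed sequence treats a special block together with this
run as one item. -/

/-- An item of a compressed sequence: a single occurrence of a symbol, or a special block
together with the descending run following it. -/
inductive Item : Type where
  | sym : ℕ → Item
  | blk : List ℕ → Item

/-- The special blocks of a compressed sequence. -/
def blocks : List Item → List (List ℕ)
  | [] => []
  | Item.sym _ :: r => blocks r
  | Item.blk b :: r => b :: blocks r

/-- The token sequence described by a compressed sequence. -/
def expand : List Item → List Tok
  | [] => []
  | Item.sym a :: r => Tok.sym a :: expand r
  | Item.blk b :: r =>
      Tok.op :: b.map Tok.sym ++ Tok.cl :: (b.dropLast.reverse.map Tok.sym ++ expand r)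

/-- The `i`-th fresh copy of a compressed sequence, with the given global symbols inserted at
the ends of its special blocks. -/
def insertCopy (i : ℕ) : List Item → List ℕ → List Item
  | [], _ => []
  | Item.sym a :: r, bs => Item.sym (loc i a) :: insertCopy i r bs
  | Item.blk c :: r, [] => Item.blk (c.map (loc i)) :: insertCopy i r []
  | Item.blk c :: r, b :: bs => Item.blk (c.map (loc i) ++ [glob b]) :: insertCopy i r bs

/-- The shuffle of compressed sequences, numbering the copies of `A` from `i` on. -/
def shuffle (A : List Item) : ℕ → List Item → List Item
  | _, [] => []
  | i, Item.sym a :: r => Item.sym (glob a) :: shuffle A i r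
  | i, Item.blk b :: r =>
      (insertCopy i A b ++ (b.map (Item.sym ∘ glob)).reverse) ++ shuffle A (i + 1) r

/-- Split all special blocks into special blocks of length 1. -/
def splitBlocks : List Item → List Item
  | [] => []
  | Item.sym a :: r => Item.sym a :: splitBlocks r
  | Item.blk b :: r =>
      (b.map (fun a => Item.blk [a]) ++ (b.dropLast.map Item.sym).reverse) ++ splitBlocks r

/-- The compressed form of `S_{k+1}(m+1)`. -/
def compressedHS : ℕ → ℕ → List Item
  | 0, m => Item.blk (List.range' 1 (m + 1)) :: (List.range' 2 m).map Item.sym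
  | k + 1, 0 => splitBlocks (compressedHS k 1)
  | k + 1, m + 1 => shuffle (compressedHS (k + 1) m) 0
      (compressedHS k ((blocks (compressedHS (k + 1) m)).length - 1))
termination_by k m => (k, m)

/-! ### Embeddings of compressed sequences -/

/-- The block `b'` contains the symbols of `b`, renamed by `f`, at the positions given by `ρ`. -/
def BlockRepresents (f ρ : ℕ → ℕ) (b b' : List ℕ) : Prop :=
  ∀ j a, b[j]? = some a → b'[ρ j]? = some (f a)

/-- The second item represents the first one under the renaming `f` and the choice `ρ` of
positions within special blocks. -/
inductive Represents (f ρ : ℕ → ℕ) : Item → Item → Prop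
  | sym (a : ℕ) : Represents f ρ (Item.sym a) (Item.sym (f a))
  | blk {b c : List ℕ} : BlockRepresents f ρ b c → Represents f ρ (Item.blk b) (Item.blk c)

/-- The compressed sequence `A'` contains `A`, special blocks being mapped to special blocks. -/
abbrev Embeds (f ρ : ℕ → ℕ) (A A' : List Item) : Prop :=
  List.SublistForall₂ (Represents f ρ) A A'

theorem sublistForall₂_append {α β : Type*} {R : α → β → Prop} {l₁ l₂ : List α}
    {l₁' l₂' : List β} (h₁ : List.SublistForall₂ R l₁ l₁') (h₂ : List.SublistForall₂ R l₂ l₂') :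
    List.SublistForall₂ R (l₁ ++ l₂) (l₁' ++ l₂') := by
  rw [List.sublistForall₂_iff] at *
  obtain ⟨u, hu, hu'⟩ := h₁
  obtain ⟨v, hv, hv'⟩ := h₂
  exact ⟨u ++ v, List.rel_append hu hv, hu'.append hv'⟩

theorem sublistForall₂_of_sublist_right {α β : Type*} {R : α → β → Prop} {l : List α}
    {l₁ l₂ : List β} (h : List.SublistForall₂ R l l₁) (hl : l₁.Sublist l₂) :
    List.SublistForall₂ R l l₂ := by
  rw [List.sublistForall₂_iff] at *
  obtain ⟨u, hu, hu'⟩ := h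
  exact ⟨u, hu, hu'.trans hl⟩

theorem sublistForall₂_comp {α β γ : Type*} {R : α → β → Prop} {S : β → γ → Prop}
    {T : α → γ → Prop} (hT : ∀ a b c, R a b → S b c → T a c) {l₁ : List α} {l₂ : List β}
    {l₃ : List γ} (h₁ : List.SublistForall₂ R l₁ l₂) (h₂ : List.SublistForall₂ S l₂ l₃) :
    List.SublistForall₂ T l₁ l₃ := by
  induction h₂ generalizing l₁ with
  | nil => cases h₁; exact .nil
  | cons h _ ih =>
    cases h₁ with
    | nil => exact .nil
    | cons h' t => exact .cons (hT _ _ _ h' h) (ih t)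
    | cons_right t => exact .cons_right (ih t)
  | cons_right _ ih => exact .cons_right (ih h₁)

theorem embeds_syms {f ρ : ℕ → ℕ} {l l' : List ℕ} (h : (l.map f).Sublist l') :
    Embeds f ρ (l.map Item.sym) (l'.map Item.sym) := by
  refine List.sublistForall₂_iff.2 ⟨(l.map f).map Item.sym, ?_, h.map _⟩
  simp only [List.map_map, List.forall₂_map_left_iff, List.forall₂_map_right_iff,
    List.forall₂_same]
  exact fun a _ => .sym a

theorem BlockRepresents.sublist {f ρ : ℕ → ℕ} (hρ : StrictMono ρ) {b b' : List ℕ}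
    (h : BlockRepresents f ρ b b') : (b.map f).Sublist b' := by
  have key : ∀ j : Fin (b.map f).length, b'[ρ j]? = some ((b.map f).get j) := by
    rintro ⟨j, hj⟩
    rw [List.length_map] at hj
    simpa using h j b[j] (by simp [hj])
  have hlt : ∀ j : Fin (b.map f).length, ρ j < b'.length := fun j =>
    (List.getElem?_eq_some_iff.1 (key j)).1
  refine List.sublist_iff_exists_fin_orderEmbedding_get_eq.2
    ⟨OrderEmbedding.ofStrictMono (fun j => ⟨ρ j, hlt j⟩) fun i j hij => hρ hij, fun j => ?_⟩
  exact (List.getElem?_eq_some_iff.1 (key j)).2.symm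

theorem Represents.comp {f g ρ : ℕ → ℕ} {x y z : Item} (h : Represents f id x y)
    (h' : Represents g ρ y z) : Represents (g ∘ f) ρ x z := by
  cases h with
  | sym a => cases h'; exact .sym (f := g ∘ f) a
  | blk hb => cases h' with
    | blk hb' => exact .blk fun j a hj => hb' _ _ (hb _ _ hj)

theorem Represents.refl {ρ : ℕ → ℕ} {n : ℕ} (hρ : ∀ j < n, ρ j = j) {x : Item}
    (hx : ∀ b, x = Item.blk b → b.length = n) : Represents id ρ x x := by
  cases x with
  | sym a => exact .sym (f := id) a
  | blk b =>
    refine .blk fun j a hj => ?_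
    have := (List.getElem?_eq_some_iff.1 hj).1
    rw [hρ j (by rw [← hx b rfl]; exact this), hj, id]

@[simp] theorem blocks_append (A B : List Item) : blocks (A ++ B) = blocks A ++ blocks B := by
  induction A with
  | nil => rfl
  | cons x r ih => cases x <;> simp [blocks, ih]

@[simp] theorem blocks_map_sym (l : List ℕ) : blocks (l.map Item.sym) = [] := by
  induction l with
  | nil => rfl
  | cons x r ih => simp [blocks, ih]

@[simp] theorem blocks_map_singleton (l : List ℕ) :
    blocks (l.map fun a => Item.blk [a]) = l.map fun a => [a] := by
  induction l with
  | nil => rfl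
  | cons x r ih => simp [blocks, ih]

theorem mem_blocks {A : List Item} {b : List ℕ} : b ∈ blocks A ↔ Item.blk b ∈ A := by
  induction A with
  | nil => simp [blocks]
  | cons x r ih => cases x <;> simp [blocks, ih]

theorem embeds_refl {ρ : ℕ → ℕ} {n : ℕ} (hρ : ∀ j < n, ρ j = j) {A : List Item}
    (hA : ∀ b ∈ blocks A, b.length = n) : Embeds id ρ A A := by
  refine List.sublistForall₂_iff.2
    ⟨A, List.forall₂_same.2 fun x hx => Represents.refl hρ fun b hb => ?_, .refl _⟩
  exact hA b (mem_blocks.2 (hb ▸ hx))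

/-! ### Embeddings into copies and shuffles -/

theorem embeds_insertCopy {f ρ : ℕ → ℕ} {A A' : List Item} (h : Embeds f ρ A A') (i : ℕ)
    (bs : List ℕ) : Embeds (loc i ∘ f) ρ A (insertCopy i A' bs) := by
  induction h generalizing bs with
  | nil => exact .nil
  | cons h _ ih =>
    cases h with
    | sym a => exact .cons (.sym (f := loc i ∘ f) a) (ih bs)
    | blk hb =>
      cases bs with
      | nil => exact .cons (.blk fun j a hj => by simp [hb j a hj]) (ih _)
      | cons d bs =>
        refine .cons (.blk fun j a hj => ?_) (ih _)
        have h' := hb j a hj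
        have := (List.getElem?_eq_some_iff.1 h').1
        rw [List.getElem?_append_left (by simpa using this)]
        simp [h']
  | @cons_right x _ _ _ ih =>
    cases x with
    | sym a => exact .cons_right (ih bs)
    | blk c => cases bs <;> exact .cons_right (ih _)

theorem exists_insertCopy_sublist_shuffle (A B : List Item) (i : ℕ) (hB : blocks B ≠ []) :
    ∃ bs, (insertCopy i A bs).Sublist (shuffle A i B) := by
  induction B with
  | nil => simp [blocks] at hB
  | cons x r ih =>
    cases x with
    | sym a =>
      obtain ⟨bs, h⟩ := ih hB
      exact ⟨bs, h.cons _⟩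
    | blk b =>
      refine ⟨b, ?_⟩
      rw [shuffle, List.append_assoc]
      exact List.sublist_append_left _ _

theorem blockRepresents_concat {F fA fB ρ : ℕ → ℕ} {n n' i i' d d' : ℕ} {c c' : List ℕ}
    (h : BlockRepresents fA ρ c c') (hc : c.length = n) (hc' : c'.length = n') (hρ : ρ n = n')
    (hloc : ∀ a, F (loc i a) = loc i' (fA a)) (hglob : ∀ b, F (glob b) = glob (fB b))
    (hd : d' = fB d) :
    BlockRepresents F ρ (c.map (loc i) ++ [glob d]) (c'.map (loc i') ++ [glob d']) := by
  intro j a hj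
  rcases lt_trichotomy j n with hlt | heq | hgt
  · rw [List.getElem?_append_left (by simpa [hc] using hlt), List.getElem?_map,
      Option.map_eq_some_iff] at hj
    obtain ⟨a, ha, rfl⟩ := hj
    have h' := h j a ha
    have := (List.getElem?_eq_some_iff.1 h').1
    rw [List.getElem?_append_left (by simpa using this)]
    simp [h', hloc]
  · subst heq
    rw [hρ]
    simp [← hc] at hj
    subst hj
    simp [← hc', hglob, hd]
  · have := (List.getElem?_eq_some_iff.1 hj).1
    simp at this
    omega

/-- An embedding of `A` into `A'` sends the `j`-th block of `A` to a block of `A'` whose index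
`s j` is strictly increasing in `j`, and extends to copies with inserted symbols. -/
theorem exists_strictMono_embeds_insertCopy {fA ρ : ℕ → ℕ} {n n' : ℕ} (hρ : ρ n = n')
    {A A' : List Item} (h : Embeds fA ρ A A') (hA : ∀ b ∈ blocks A, b.length = n)
    (hA' : ∀ b ∈ blocks A', b.length = n') :
    ∃ s : ℕ → ℕ, StrictMono s ∧ (∀ j < (blocks A).length, s j < (blocks A').length) ∧
      ∀ (F fB : ℕ → ℕ) (i i' : ℕ) (b b' : List ℕ), (∀ a, F (loc i a) = loc i' (fA a)) →
        (∀ a, F (glob a) = glob (fB a)) → b.length = (blocks A).length →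
        b'.length = (blocks A').length → BlockRepresents fB s b b' →
        Embeds F ρ (insertCopy i A b) (insertCopy i' A' b') := by
  induction h with
  | nil => exact ⟨id, strictMono_id, by simp [blocks], fun _ _ _ _ _ _ _ _ _ _ _ => .nil⟩
  | @cons x x' l l' h _ ih =>
    cases h with
    | sym a =>
      obtain ⟨s, hs, hlt, hemb⟩ := ih hA hA'
      refine ⟨s, hs, hlt, fun F fB i i' b b' hl hg hb hb' hr => ?_⟩
      simp only [insertCopy, ← hl]
      exact .cons (.sym _) (hemb F fB i i' b b' hl hg hb hb' hr)
    | @blk c c' hc =>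
      simp only [blocks, List.mem_cons, forall_eq_or_imp] at hA hA'
      obtain ⟨s, hs, hlt, hemb⟩ := ih hA.2 hA'.2
      refine ⟨fun j => j.casesOn 0 fun j => s j + 1, ?_, ?_, ?_⟩
      · refine strictMono_nat_of_lt_succ fun j => ?_
        cases j with
        | zero => simp
        | succ j => simpa using hs (Nat.lt_succ_self j)
      · intro j hj
        cases j with
        | zero => simp [blocks]
        | succ j => simpa [blocks] using hlt j (by simpa [blocks] using hj)
      · intro F fB i i' b b' hl hg hb hb' hr
        cases b with
        | nil => simp [blocks] at hb
        | cons d b =>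
          cases b' with
          | nil => simp [blocks] at hb'
          | cons d' b' =>
            refine .cons (.blk (blockRepresents_concat hc hA.1 hA'.1 hρ hl hg ?_))
              (hemb F fB i i' b b' hl hg ?_ ?_ ?_)
            · simpa using hr 0 d rfl
            · simpa [blocks] using hb
            · simpa [blocks] using hb'
            · exact fun j a hj => by simpa using hr (j + 1) a (by simpa using hj)
  | @cons_right x' l l' _ ih =>
    cases x' with
    | sym a =>
      obtain ⟨s, hs, hlt, hemb⟩ := ih hA hA'
      exact ⟨s, hs, hlt, fun F fB i i' b b' hl hg hb hb' hr =>
        .cons_right (hemb F fB i i' b b' hl hg hb hb' hr)⟩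
    | blk c' =>
      simp only [blocks, List.mem_cons, forall_eq_or_imp] at hA'
      obtain ⟨s, hs, hlt, hemb⟩ := ih hA hA'.2
      refine ⟨fun j => s j + 1, fun a b hab => Nat.succ_lt_succ (hs hab),
        fun j hj => Nat.succ_lt_succ (hlt j hj), fun F fB i i' b b' hl hg hb hb' hr => ?_⟩
      cases b' with
      | nil => simp [blocks] at hb'
      | cons d' b' =>
        exact .cons_right (hemb F fB i i' b b' hl hg hb (by simpa [blocks] using hb')
          fun j a hj => by simpa using hr j a hj)

theorem embeds_shuffle {fA fB ρ s : ℕ → ℕ} {A A' B B' : List Item} (hs : StrictMono s)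
    (hcopy : ∀ (F : ℕ → ℕ) (i i' : ℕ) (b b' : List ℕ), (∀ a, F (loc i a) = loc i' (fA a)) →
        (∀ a, F (glob a) = glob (fB a)) → b.length = (blocks A).length →
        b'.length = (blocks A').length → BlockRepresents fB s b b' →
        Embeds F ρ (insertCopy i A b) (insertCopy i' A' b'))
    (h : Embeds fB s B B') (hB : ∀ b ∈ blocks B, b.length = (blocks A).length)
    (hB' : ∀ b ∈ blocks B', b.length = (blocks A').length) :
    ∃ σ : ℕ → ℕ, ∀ (F : ℕ → ℕ) (i i' : ℕ),
      (∀ j a, F (loc (i + j) a) = loc (i' + σ j) (fA a)) → (∀ a, F (glob a) = glob (fB a)) →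
      Embeds F ρ (shuffle A i B) (shuffle A' i' B') := by
  induction h with
  | nil => exact ⟨id, fun _ _ _ _ _ => .nil⟩
  | @cons x x' l l' h _ ih =>
    cases h with
    | sym a =>
      obtain ⟨σ, hσ⟩ := ih hB hB'
      refine ⟨σ, fun F i i' hl hg => ?_⟩
      simp only [shuffle, ← hg]
      exact .cons (.sym _) (hσ F i i' hl hg)
    | @blk b b' hb =>
      simp only [blocks, List.mem_cons, forall_eq_or_imp] at hB hB'
      obtain ⟨σ, hσ⟩ := ih hB.2 hB'.2
      refine ⟨fun j => j.casesOn 0 fun j => σ j + 1, fun F i i' hl hg => ?_⟩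
      refine sublistForall₂_append (sublistForall₂_append
        (hcopy F i i' b b' (fun a => hl 0 a) hg hB.1 hB'.1 hb) ?_) (hσ F _ _ (fun j a => ?_) hg)
      · simp only [← List.map_reverse, ← List.map_map]
        refine embeds_syms ?_
        rw [List.map_reverse, List.map_reverse, List.map_reverse, List.reverse_sublist,
          List.map_map, show F ∘ glob = glob ∘ fB from funext hg, ← List.map_map]
        exact (hb.sublist hs).map _
      · rw [Nat.add_right_comm, Nat.add_assoc, hl (j + 1) a]
        simp [Nat.add_comm, Nat.add_left_comm]
  | @cons_right x' l l' _ ih =>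
    cases x' with
    | sym a =>
      obtain ⟨σ, hσ⟩ := ih hB hB'
      exact ⟨σ, fun F i i' hl hg => .cons_right (hσ F i i' hl hg)⟩
    | blk b' =>
      simp only [blocks, List.mem_cons, forall_eq_or_imp] at hB'
      obtain ⟨σ, hσ⟩ := ih hB hB'.2
      refine ⟨fun j => σ j + 1, fun F i i' hl hg => ?_⟩
      refine sublistForall₂_of_sublist_right (hσ F i (i' + 1) (fun j a => ?_) hg)
        (List.sublist_append_right _ _)
      rw [hl j a]
      simp [Nat.add_comm, Nat.add_left_comm]

/-- The renaming of a shuffle induced by renamings of copy indices, local and global symbols. -/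
def shuffleRename (σ fA fB : ℕ → ℕ) (x : ℕ) : ℕ :=
  if x % 2 = 0 then loc (σ (x / 2).unpair.1) (fA (x / 2).unpair.2) else glob (fB (x / 2))

theorem shuffleRename_loc (σ fA fB : ℕ → ℕ) (i a : ℕ) :
    shuffleRename σ fA fB (loc i a) = loc (σ i) (fA a) := by
  simp [shuffleRename, loc]

theorem shuffleRename_glob (σ fA fB : ℕ → ℕ) (a : ℕ) :
    shuffleRename σ fA fB (glob a) = glob (fB a) := by
  have h : (2 * a + 1) / 2 = a := by omega
  simp [shuffleRename, glob, h, Nat.add_mod]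

/-! ### Embeddings of split sequences -/

theorem embeds_singletons_insertCopy {f ρ : ℕ → ℕ} {n' : ℕ} (hρ : ρ 0 = n') (i : ℕ)
    {A' : List Item} (hA' : ∀ b ∈ blocks A', b.length = n') {b b' : List ℕ}
    (h : (b.map f).Sublist b') (hb' : b'.length = (blocks A').length) :
    Embeds (glob ∘ f) ρ (b.map fun a => Item.blk [a]) (insertCopy i A' b') := by
  induction A' generalizing b b' with
  | nil =>
    simp only [blocks, List.length_nil, List.length_eq_zero_iff] at hb'
    subst hb'
    simp only [List.sublist_nil, List.map_eq_nil_iff] at h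
    subst h
    exact .nil
  | cons x r ih =>
    cases x with
    | sym a => exact .cons_right (ih hA' h hb')
    | blk c =>
      simp only [blocks, List.mem_cons, forall_eq_or_imp] at hA'
      cases b' with
      | nil => simp [blocks] at hb'
      | cons d' b' =>
        have hb'' : b'.length = (blocks r).length := by simpa [blocks] using hb'
        cases b with
        | nil => exact .nil
        | cons d b =>
          rw [List.map_cons] at h
          rcases List.cons_sublist_cons'.1 h with h | ⟨hd, h⟩
          · exact .cons_right (ih hA'.2 (b := d :: b) (by simpa using h) hb'')
          · refine .cons (.blk fun j a hj => ?_) (ih hA'.2 h hb'')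
            cases j with
            | zero =>
              simp only [List.getElem?_cons_zero, Option.some.injEq] at hj
              subst hj
              simp [hρ, ← hA'.1, hd]
            | succ j => simp at hj

theorem embeds_splitBlocks_shuffle {f ρ s : ℕ → ℕ} (hs : StrictMono s) {n' : ℕ} (hρ : ρ 0 = n')
    {A' B B' : List Item} (hA' : ∀ b ∈ blocks A', b.length = n')
    (hB' : ∀ b ∈ blocks B', b.length = (blocks A').length) (h : Embeds f s B B') (i : ℕ) :
    Embeds (glob ∘ f) ρ (splitBlocks B) (shuffle A' i B') := by
  induction h generalizing i with
  | nil => exact .nil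
  | @cons x x' l l' h _ ih =>
    cases h with
    | sym a => exact .cons (.sym (f := glob ∘ f) a) (ih hB' i)
    | @blk b b' hb =>
      simp only [blocks, List.mem_cons, forall_eq_or_imp] at hB'
      refine sublistForall₂_append (sublistForall₂_append
        (embeds_singletons_insertCopy hρ i hA' (hb.sublist hs) hB'.1) ?_) (ih hB'.2 _)
      rw [← List.map_map, ← List.map_reverse, ← List.map_reverse]
      refine embeds_syms ?_
      rw [List.map_reverse, List.reverse_sublist, ← List.map_map]
      exact (((List.dropLast_sublist b).map f).trans (hb.sublist hs)).map _
  | @cons_right x' l l' _ ih =>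
    cases x' with
    | sym a => exact .cons_right (ih hB' i)
    | blk b' =>
      simp only [blocks, List.mem_cons, forall_eq_or_imp] at hB'
      exact sublistForall₂_of_sublist_right (ih hB'.2 _) (List.sublist_append_right _ _)

theorem embeds_splitBlocks {f ρ s : ℕ → ℕ} (hs : StrictMono s) (hρ : ρ 0 = 0)
    {B B' : List Item} (h : Embeds f s B B') :
    Embeds f ρ (splitBlocks B) (splitBlocks B') := by
  induction h with
  | nil => exact .nil
  | @cons x x' l l' h _ ih =>
    cases h with
    | sym a => exact .cons (.sym a) ih
    | @blk b b' hb =>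
      refine sublistForall₂_append (sublistForall₂_append ?_ ?_) ih
      · rw [List.sublistForall₂_iff]
        refine ⟨(b.map f).map fun a => Item.blk [a], ?_, (hb.sublist hs).map _⟩
        simp only [List.map_map, List.forall₂_map_left_iff, List.forall₂_map_right_iff,
          List.forall₂_same]
        refine fun a _ => .blk fun j a' hj => ?_
        cases j with
        | zero => simpa [hρ] using congrArg f (by simpa using hj)
        | succ j => simp at hj
      · rw [← List.map_reverse, ← List.map_reverse]
        refine embeds_syms ?_
        rw [List.map_reverse, List.map_dropLast, ← List.tail_reverse, ← List.tail_reverse]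
        exact (List.reverse_sublist.2 (hb.sublist hs)).tail
  | @cons_right x' l l' _ ih =>
    cases x' with
    | sym a => exact .cons_right ih
    | blk b' => exact sublistForall₂_of_sublist_right ih (List.sublist_append_right _ _)

theorem splitBlocks_eq_self {B : List Item} (hB : ∀ b ∈ blocks B, b.length = 1) :
    splitBlocks B = B := by
  induction B with
  | nil => rfl
  | cons x r ih =>
    cases x with
    | sym a => rw [splitBlocks, ih hB]
    | blk b =>
      simp only [blocks, List.mem_cons, forall_eq_or_imp] at hB
      obtain ⟨a, rfl⟩ := List.length_eq_one_iff.1 hB.1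
      simp [splitBlocks, ih hB.2]

/-! ### Well-formedness of the compressed Hart–Sharir sequences -/

/-- All special blocks have length `n`, no symbol occurs twice in the special blocks, and every
symbol occurs in a special block. -/
structure WellFormed (n : ℕ) (A : List Item) : Prop where
  length_eq : ∀ b ∈ blocks A, b.length = n
  nodup : (blocks A).flatten.Nodup
  covered : ∀ a, Item.sym a ∈ A → a ∈ (blocks A).flatten

theorem loc_inj {i i' a a' : ℕ} : loc i a = loc i' a' ↔ i = i' ∧ a = a' := by
  simp [loc, Nat.pair_eq_pair]

theorem loc_ne_glob (i a b : ℕ) : loc i a ≠ glob b := by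
  simp only [loc, glob]
  omega

theorem glob_injective : Function.Injective glob := fun a b h => by
  simp only [glob] at h
  omega

theorem length_blocks_insertCopy (i : ℕ) (A : List Item) (bs : List ℕ) :
    (blocks (insertCopy i A bs)).length = (blocks A).length := by
  induction A generalizing bs with
  | nil => rfl
  | cons x r ih =>
    cases x with
    | sym a => exact ih bs
    | blk c => cases bs <;> simp [insertCopy, blocks, ih]

theorem flatten_blocks_insertCopy_perm (i : ℕ) {A : List Item} {bs : List ℕ}
    (h : bs.length = (blocks A).length) :
    (blocks (insertCopy i A bs)).flatten.Perm
      ((blocks A).flatten.map (loc i) ++ bs.map glob) := by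
  induction A generalizing bs with
  | nil =>
    simp only [blocks, List.length_nil, List.length_eq_zero_iff] at h
    simp [insertCopy, blocks, h]
  | cons x r ih =>
    cases x with
    | sym a => exact ih h
    | blk c =>
      cases bs with
      | nil => simp [blocks] at h
      | cons b bs =>
        have := ih (bs := bs) (by simpa [blocks] using h)
        simp only [insertCopy, blocks, List.flatten_cons, List.map_append, List.map_cons,
          List.append_assoc, List.singleton_append]
        exact ((this.cons _).trans List.perm_middle.symm).append_left _

theorem length_of_mem_blocks_insertCopy (i : ℕ) {n : ℕ} {A : List Item} {bs : List ℕ}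
    (hA : ∀ b ∈ blocks A, b.length = n) (h : bs.length = (blocks A).length) :
    ∀ b ∈ blocks (insertCopy i A bs), b.length = n + 1 := by
  induction A generalizing bs with
  | nil => simp [insertCopy, blocks]
  | cons x r ih =>
    cases x with
    | sym a => exact ih hA h
    | blk c =>
      simp only [blocks, List.mem_cons, forall_eq_or_imp] at hA
      cases bs with
      | nil => simp [blocks] at h
      | cons b bs =>
        simp only [insertCopy, blocks, List.mem_cons, forall_eq_or_imp]
        exact ⟨by simp [hA.1], ih hA.2 (by simpa [blocks] using h)⟩

theorem sym_mem_insertCopy {i x : ℕ} {A : List Item} {bs : List ℕ}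
    (h : Item.sym x ∈ insertCopy i A bs) : ∃ a, Item.sym a ∈ A ∧ x = loc i a := by
  induction A generalizing bs with
  | nil => simp [insertCopy] at h
  | cons y r ih =>
    cases y with
    | sym a =>
      rcases List.mem_cons.1 h with h | h
      · exact ⟨a, by simp, by simpa using h⟩
      · obtain ⟨a, ha, hx⟩ := ih h
        exact ⟨a, by simp [ha], hx⟩
    | blk c =>
      cases bs <;>
      · obtain ⟨a, ha, hx⟩ := ih (by simpa [insertCopy] using h)
        exact ⟨a, by simp [ha], hx⟩

theorem blocks_shuffle_blk (A : List Item) (i : ℕ) (b : List ℕ) (r : List Item) :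
    blocks (shuffle A i (Item.blk b :: r)) =
      blocks (insertCopy i A b) ++ blocks (shuffle A (i + 1) r) := by
  simp [shuffle, ← List.map_map, ← List.map_reverse]

theorem length_blocks_shuffle (A : List Item) (i : ℕ) (B : List Item) :
    (blocks (shuffle A i B)).length = (blocks A).length * (blocks B).length := by
  induction B generalizing i with
  | nil => rfl
  | cons x r ih =>
    cases x with
    | sym a => exact ih i
    | blk b =>
      rw [blocks_shuffle_blk, List.length_append, ih, length_blocks_insertCopy, blocks,
        List.length_cons]
      ring

theorem flatten_blocks_shuffle_perm {A B : List Item} (i : ℕ)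
    (hB : ∀ b ∈ blocks B, b.length = (blocks A).length) :
    (blocks (shuffle A i B)).flatten.Perm
      ((List.range' i (blocks B).length).flatMap (fun j => (blocks A).flatten.map (loc j)) ++
        (blocks B).flatten.map glob) := by
  induction B generalizing i with
  | nil => simp [shuffle, blocks]
  | cons x r ih =>
    cases x with
    | sym a => exact ih i hB
    | blk b =>
      simp only [blocks, List.mem_cons, forall_eq_or_imp] at hB
      rw [blocks_shuffle_blk, List.flatten_append]
      refine ((flatten_blocks_insertCopy_perm i hB.1).append (ih (i + 1) hB.2)).trans ?_
      simp only [blocks, List.length_cons, List.range'_succ, List.flatMap_cons,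
        List.flatten_cons, List.map_append, List.append_assoc]
      refine List.Perm.append_left _ ?_
      simp only [← List.append_assoc]
      exact List.perm_append_comm.append_right _

theorem WellFormed.shuffle {n : ℕ} {A B : List Item} (hA : WellFormed n A)
    (hB : WellFormed (blocks A).length B) : WellFormed (n + 1) (shuffle A 0 B) where
  length_eq := by
    have hlen := hB.length_eq
    clear hB
    generalize 0 = i
    induction B generalizing i with
    | nil => simp [HartSharir.shuffle, blocks]
    | cons x r ih =>
      cases x with
      | sym a => exact ih hlen i
      | blk b =>
        simp only [blocks, List.mem_cons, forall_eq_or_imp] at hlen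
        rw [blocks_shuffle_blk]
        intro c hc
        rcases List.mem_append.1 hc with hc | hc
        · exact length_of_mem_blocks_insertCopy i hA.length_eq hlen.1 c hc
        · exact ih hlen.2 _ c hc
  nodup := by
    rw [(flatten_blocks_shuffle_perm 0 hB.length_eq).nodup_iff, List.nodup_append',
      List.nodup_flatMap]
    refine ⟨⟨fun i _ => hA.nodup.map fun a b h => (loc_inj.1 h).2, ?_⟩,
      hB.nodup.map glob_injective, ?_⟩
    · refine (List.nodup_range' (step := 1)).imp fun {i j} hij x hi hj => ?_
      obtain ⟨a, -, rfl⟩ := List.mem_map.1 hi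
      obtain ⟨b, -, h⟩ := List.mem_map.1 hj
      exact hij (loc_inj.1 h).1.symm
    · intro x hx hx'
      obtain ⟨i, -, hx⟩ := List.mem_flatMap.1 hx
      obtain ⟨a, -, rfl⟩ := List.mem_map.1 hx
      obtain ⟨b, -, h⟩ := List.mem_map.1 hx'
      exact loc_ne_glob _ _ _ h.symm
  covered := by
    intro x hx
    rw [(flatten_blocks_shuffle_perm 0 hB.length_eq).mem_iff]
    have key : ∀ (l : List Item) (i : ℕ), Item.sym x ∈ HartSharir.shuffle A i l →
        (∃ j, i ≤ j ∧ j < i + (blocks l).length ∧ ∃ a, Item.sym a ∈ A ∧ x = loc j a) ∨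
        ∃ a, (Item.sym a ∈ l ∨ a ∈ (blocks l).flatten) ∧ x = glob a := by
      intro l
      induction l with
      | nil => simp [HartSharir.shuffle]
      | cons y r ih =>
        intro i hx
        cases y with
        | sym a =>
          rcases List.mem_cons.1 hx with h | h
          · exact .inr ⟨a, by simp, by simpa using h⟩
          · rcases ih i h with h | ⟨a, ha, hx⟩
            · exact .inl h
            · exact .inr ⟨a, ha.imp (List.mem_cons_of_mem _) id, hx⟩
        | blk b =>
          rcases List.mem_append.1 hx with h | h
          · rcases List.mem_append.1 h with h | h
            · exact .inl ⟨i, le_rfl, by simp [blocks], sym_mem_insertCopy h⟩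
            · simp only [List.mem_reverse, List.mem_map, Function.comp_apply,
                Item.sym.injEq] at h
              obtain ⟨a, ha, rfl⟩ := h
              exact .inr ⟨a, .inr (by simp [blocks, ha]), rfl⟩
          · rcases ih (i + 1) h with ⟨j, hj, hj', h⟩ | ⟨a, ha, hx⟩
            · exact .inl ⟨j, by omega, by simp only [blocks, List.length_cons]; omega, h⟩
            · refine .inr ⟨a, ha.imp (List.mem_cons_of_mem _) fun h => ?_, hx⟩
              rw [blocks, List.flatten_cons]
              exact List.mem_append_right _ h
    rw [List.mem_append]
    rcases key B 0 hx with ⟨j, hj, hj', a, ha, rfl⟩ | ⟨a, ha, rfl⟩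
    · refine .inl (List.mem_flatMap.2 ⟨j, ?_, List.mem_map_of_mem (hA.covered a ha)⟩)
      rw [List.mem_range'_1]
      exact ⟨hj, hj'⟩
    · exact .inr (List.mem_map_of_mem (ha.elim (hB.covered a) id))

theorem blocks_splitBlocks (B : List Item) :
    blocks (splitBlocks B) = (blocks B).flatten.map fun a => [a] := by
  induction B with
  | nil => rfl
  | cons x r ih =>
    cases x with
    | sym a => exact ih
    | blk b =>
      rw [splitBlocks, ← List.map_reverse]
      simp only [blocks_append, blocks_map_singleton, blocks_map_sym, ih, blocks,
        List.flatten_cons, List.map_append, List.append_nil]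

theorem flatten_blocks_splitBlocks (B : List Item) :
    (blocks (splitBlocks B)).flatten = (blocks B).flatten := by
  rw [blocks_splitBlocks, ← List.flatMap_def, List.flatMap_singleton']

theorem WellFormed.splitBlocks {n : ℕ} {B : List Item} (hB : WellFormed n B) :
    WellFormed 1 (splitBlocks B) where
  length_eq := by
    intro b hb
    rw [blocks_splitBlocks, List.mem_map] at hb
    obtain ⟨a, -, rfl⟩ := hb
    rfl
  nodup := by simpa [flatten_blocks_splitBlocks] using hB.nodup
  covered := by
    rw [flatten_blocks_splitBlocks]
    have key : ∀ (l : List Item) (x : ℕ), Item.sym x ∈ HartSharir.splitBlocks l →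
        Item.sym x ∈ l ∨ x ∈ (blocks l).flatten := by
      intro l x
      induction l with
      | nil => simp [HartSharir.splitBlocks]
      | cons y r ih =>
        intro hx
        cases y with
        | sym a =>
          rcases List.mem_cons.1 hx with h | h
          · exact .inl (by simp [h])
          · exact (ih h).imp (List.mem_cons_of_mem _) id
        | blk b =>
          simp only [HartSharir.splitBlocks, List.mem_append, List.mem_reverse, List.mem_map,
            reduceCtorEq, and_false, exists_false, false_or, Item.sym.injEq,
            exists_eq_right] at hx
          rw [blocks, List.flatten_cons, List.mem_append]
          rcases hx with h | h
          · exact .inr (.inl (List.mem_of_mem_dropLast h))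
          · exact (ih h).imp (List.mem_cons_of_mem _) .inr
    exact fun x hx => (key B x hx).elim (hB.covered x) id

theorem blocks_compressedHS_zero (m : ℕ) :
    blocks (compressedHS 0 m) = [List.range' 1 (m + 1)] := by
  simp [compressedHS, blocks]

theorem wellFormed_compressedHS_zero (m : ℕ) : WellFormed (m + 1) (compressedHS 0 m) where
  length_eq := by simp [blocks_compressedHS_zero]
  nodup := by simpa [blocks_compressedHS_zero] using List.nodup_range' (step := 1)
  covered := by
    simp [compressedHS, blocks, List.mem_range'_1]
    omega

theorem wellFormed_compressedHS (k m : ℕ) :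
    WellFormed (m + 1) (compressedHS k m) ∧ 1 ≤ (blocks (compressedHS k m)).length ∧
      (1 ≤ k → 2 ≤ (blocks (compressedHS k m)).length) := by
  induction k generalizing m with
  | zero => exact ⟨wellFormed_compressedHS_zero m, by simp [blocks_compressedHS_zero], by simp⟩
  | succ k ihk =>
    suffices h : WellFormed (m + 1) (compressedHS (k + 1) m) ∧
        2 ≤ (blocks (compressedHS (k + 1) m)).length from ⟨h.1, by omega, fun _ => h.2⟩
    induction m with
    | zero =>
      obtain ⟨hwf, hpos, -⟩ := ihk 1
      rw [compressedHS]
      refine ⟨hwf.splitBlocks, ?_⟩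
      rw [blocks_splitBlocks, List.length_map]
      obtain ⟨b, l, hb⟩ := List.exists_cons_of_length_pos hpos
      rw [hb, List.flatten_cons, List.length_append, hwf.length_eq b (by simp [hb])]
      omega
    | succ m ihm =>
      obtain ⟨hwf, hpos⟩ := ihm
      rw [compressedHS]
      obtain ⟨hwf', hpos', -⟩ := ihk ((blocks (compressedHS (k + 1) m)).length - 1)
      rw [Nat.sub_add_cancel (by omega)] at hwf'
      exact ⟨hwf.shuffle hwf', by rw [length_blocks_shuffle]; nlinarith⟩

/-! ### Embeddings between the compressed Hart–Sharir sequences -/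

theorem blockRepresents_range' {ρ : ℕ → ℕ} (hρ : StrictMono ρ) {m m' : ℕ} (h : ρ m ≤ m') :
    BlockRepresents (fun x => ρ (x - 1) + 1) ρ (List.range' 1 (m + 1))
      (List.range' 1 (m' + 1)) := by
  intro j a hj
  rw [List.getElem?_eq_some_iff] at hj ⊢
  obtain ⟨hj, rfl⟩ := hj
  rw [List.length_range'] at hj
  have : ρ j ≤ ρ m := hρ.monotone (by omega)
  exact ⟨by rw [List.length_range']; omega, by simp; omega⟩

theorem embeds_compressedHS_zero {ρ : ℕ → ℕ} (hρ : StrictMono ρ) {m m' : ℕ} (h : ρ m ≤ m') :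
    Embeds (fun x => ρ (x - 1) + 1) ρ (compressedHS 0 m) (compressedHS 0 m') := by
  have hrep := blockRepresents_range' hρ h
  rw [compressedHS, compressedHS]
  refine .cons (.blk hrep) (embeds_syms ?_)
  refine List.Sublist.trans ?_ (hrep.sublist hρ).tail
  rw [List.range'_succ, List.map_cons, List.tail_cons]

theorem insertCopy_map_sym (i : ℕ) (l bs : List ℕ) :
    insertCopy i (l.map Item.sym) bs = (l.map (loc i)).map Item.sym := by
  induction l with
  | nil => rfl
  | cons a l ih => simp [insertCopy, ih]

/-- `S₁(m+2)` is the shuffle of `S₁(m+1)` with `S₁(1)`, up to renaming. -/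
theorem embeds_compressedHS_zero_shuffle (m : ℕ) :
    ∃ f, Embeds f id (compressedHS 0 (m + 1))
      (shuffle (compressedHS 0 m) 0 (compressedHS 0 0)) := by
  let f : ℕ → ℕ := fun x => if x = m + 2 then glob 1 else loc 0 x
  have hmap : ∀ s n, s + n = m + 2 →
      (List.range' s n).map (loc 0) ++ [glob 1] = (List.range' s (n + 1)).map f := by
    intro s n hn
    rw [List.range'_1_concat, List.map_append, hn]
    congr 1
    · refine List.map_congr_left fun x hx => ?_
      rw [List.mem_range'_1] at hx
      exact (if_neg (by omega)).symm
    · simp [f]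
  have htarget : shuffle (compressedHS 0 m) 0 (compressedHS 0 0) =
      Item.blk ((List.range' 1 (m + 2)).map f) ::
        ((List.range' 2 (m + 1)).map f).map Item.sym := by
    rw [← hmap 1 (m + 1) (by omega), ← hmap 2 m (by omega)]
    simp [compressedHS, shuffle, insertCopy, insertCopy_map_sym]
  refine ⟨f, ?_⟩
  rw [htarget, compressedHS]
  exact .cons (.blk fun j a hj => by simp [hj]) (embeds_syms (.refl _))

theorem embeds_shuffle_compressedHS {k k' m m' : ℕ} {A B : List Item} {fA ρ : ℕ → ℕ}
    (hρ : ρ (m + 1) = m' + 1) (hA : WellFormed (m + 1) A)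
    (hemb : Embeds fA ρ A (compressedHS (k' + 1) m'))
    (hB : B = compressedHS k ((blocks A).length - 1)) (hpos : 1 ≤ (blocks A).length)
    (ih : ∀ (m' m : ℕ) (ρ : ℕ → ℕ), StrictMono ρ → ρ m ≤ m' →
      ∃ f, Embeds f ρ (compressedHS k m) (compressedHS k' m')) :
    ∃ f, Embeds f ρ (shuffle A 0 B) (compressedHS (k' + 1) (m' + 1)) := by
  obtain ⟨hA', hpos', -⟩ := wellFormed_compressedHS (k' + 1) m'
  rw [compressedHS]
  obtain ⟨s, hs, hlt, hcopy⟩ :=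
    exists_strictMono_embeds_insertCopy hρ hemb hA.length_eq hA'.length_eq
  obtain ⟨fB, hfB⟩ := ih ((blocks (compressedHS (k' + 1) m')).length - 1)
    ((blocks A).length - 1) s hs (Nat.le_sub_one_of_lt (hlt _ (by omega)))
  have hlen : ∀ b ∈ blocks B, b.length = (blocks A).length := fun b hb => by
    rw [(wellFormed_compressedHS k _).1.length_eq b (hB ▸ hb)]
    omega
  have hlen' : ∀ b ∈ blocks (compressedHS k' ((blocks (compressedHS (k' + 1) m')).length - 1)),
      b.length = (blocks (compressedHS (k' + 1) m')).length := fun b hb => by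
    rw [(wellFormed_compressedHS k' _).1.length_eq b hb]
    omega
  obtain ⟨σ, hσ⟩ := embeds_shuffle hs (fun F => hcopy F fB) (hB ▸ hfB) hlen hlen'
  refine ⟨shuffleRename σ fA fB, hσ _ 0 0 (fun j a => ?_) (shuffleRename_glob σ fA fB)⟩
  rw [Nat.zero_add, Nat.zero_add, shuffleRename_loc]

theorem exists_embeds_compressedHS (k' : ℕ) : ∀ (m' k m : ℕ) (ρ : ℕ → ℕ), k ≤ k' →
    StrictMono ρ → ρ m ≤ m' → ∃ f, Embeds f ρ (compressedHS k m) (compressedHS k' m') := by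
  induction k' with
  | zero =>
    intro m' k m ρ hk hρ hm
    obtain rfl : k = 0 := by omega
    exact ⟨_, embeds_compressedHS_zero hρ hm⟩
  | succ k' ihk =>
    intro m'
    induction m' with
    | zero =>
      intro k m ρ hk hρ hm
      have hle := hρ.id_le m
      obtain rfl : m = 0 := by simp only [id] at hle; omega
      obtain rfl | hk : k = k' + 1 ∨ k ≤ k' := by omega
      · exact ⟨id, embeds_refl (n := 1)
          (fun j hj => by rw [Nat.lt_one_iff.1 hj]; omega)
          (wellFormed_compressedHS (k' + 1) 0).1.length_eq⟩
      · obtain ⟨f, hf⟩ := ihk 1 k 0 id hk strictMono_id (by simp)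
        refine ⟨f, ?_⟩
        rw [compressedHS, ← splitBlocks_eq_self (wellFormed_compressedHS k 0).1.length_eq]
        exact embeds_splitBlocks strictMono_id (by omega) hf
    | succ m' ihm =>
      intro k m ρ hk hρ hm
      obtain ⟨hA', hpos', htwo⟩ := wellFormed_compressedHS (k' + 1) m'
      have htwo := htwo (by omega)
      obtain ⟨hB', hposB', -⟩ :=
        wellFormed_compressedHS k' ((blocks (compressedHS (k' + 1) m')).length - 1)
      rw [Nat.sub_add_cancel hpos'] at hB'
      obtain hm | hm : ρ m ≤ m' ∨ ρ m = m' + 1 := by omega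
      · obtain ⟨f, hf⟩ := ihm k m ρ hk hρ hm
        rw [compressedHS]
        obtain ⟨bs, hbs⟩ := exists_insertCopy_sublist_shuffle (compressedHS (k' + 1) m') _ 0
          (List.ne_nil_of_length_pos hposB')
        exact ⟨_, sublistForall₂_of_sublist_right (embeds_insertCopy hf 0 bs) hbs⟩
      cases m with
      | zero =>
        have hsplit : ∃ n f, compressedHS k 0 = splitBlocks (compressedHS (min k k') n) ∧
            Embeds f id (compressedHS (min k k') n)
              (compressedHS k' ((blocks (compressedHS (k' + 1) m')).length - 1)) := by
          obtain rfl | hk : k = k' + 1 ∨ k ≤ k' := by omega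
          · obtain ⟨f, hf⟩ := ihk ((blocks (compressedHS (k' + 1) m')).length - 1) k' 1 id le_rfl
              strictMono_id (by simp only [id]; omega)
            rw [min_eq_right (Nat.le_succ k')]
            exact ⟨1, f, by rw [compressedHS], hf⟩
          · obtain ⟨f, hf⟩ := ihk ((blocks (compressedHS (k' + 1) m')).length - 1) k 0 id hk
              strictMono_id (by simp)
            rw [min_eq_left hk]
            exact ⟨0, f, (splitBlocks_eq_self (wellFormed_compressedHS k 0).1.length_eq).symm, hf⟩
        obtain ⟨n, f, heq, hf⟩ := hsplit
        rw [heq, compressedHS]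
        exact ⟨_, embeds_splitBlocks_shuffle strictMono_id hm hA'.length_eq hB'.length_eq hf 0⟩
      | succ m =>
        obtain ⟨fA, hfA⟩ := ihm k m ρ hk hρ (by have := hρ (Nat.lt_add_one m); omega)
        obtain ⟨hA, hpos, -⟩ := wellFormed_compressedHS k m
        cases k with
        | zero =>
          obtain ⟨g, hg⟩ := embeds_compressedHS_zero_shuffle m
          obtain ⟨f, hf⟩ := embeds_shuffle_compressedHS hm hA hfA (k := 0)
            (B := compressedHS 0 0) (by simp [blocks_compressedHS_zero]) hpos
            fun m' m ρ => ihk m' 0 m ρ (Nat.zero_le _)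
          exact ⟨f ∘ g, sublistForall₂_comp (fun _ _ _ h h' => h.comp h') hg hf⟩
        | succ k =>
          rw [compressedHS]
          exact embeds_shuffle_compressedHS hm hA hfA rfl hpos
            fun m' m ρ => ihk m' k m ρ (by omega)

/-! ### Expanding compressed sequences -/

theorem symsOf_append (u v : List Tok) : symsOf (u ++ v) = symsOf u ++ symsOf v := by
  induction u with
  | nil => rfl
  | cons t u ih => cases t <;> simp [symsOf, ih]

theorem symsOf_map_sym (l : List ℕ) : symsOf (l.map Tok.sym) = l := by
  induction l with
  | nil => rfl
  | cons a l ih => simp [symsOf, ih]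

theorem symsOf_expand_blk (b : List ℕ) (r : List Item) :
    symsOf (expand (Item.blk b :: r)) = b ++ (b.dropLast.reverse ++ symsOf (expand r)) := by
  simp only [expand, List.cons_append, symsOf, symsOf_append, symsOf_map_sym]

theorem takeBlock_map_sym (b : List ℕ) (r : List Tok) :
    takeBlock (b.map Tok.sym ++ Tok.cl :: r) = (b, r) := by
  induction b with
  | nil => rfl
  | cons a b ih => simp [takeBlock, ih]

theorem blocksOf_map_sym_append (l : List ℕ) (r : List Tok) :
    blocksOf (l.map Tok.sym ++ r) = blocksOf r := by
  induction l with
  | nil => rfl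
  | cons a l ih => simpa [blocksOf] using ih

theorem blocksOf_expand (A : List Item) : blocksOf (expand A) = blocks A := by
  induction A with
  | nil => simp [expand, blocks, blocksOf]
  | cons x r ih =>
    cases x with
    | sym a => simpa [expand, blocks, blocksOf] using ih
    | blk b =>
      rw [expand, blocks, List.cons_append, blocksOf, takeBlock_map_sym,
        blocksOf_map_sym_append, ih]

theorem count_op_map_sym (l : List ℕ) : (l.map Tok.sym).count Tok.op = 0 := by
  simp [List.count_eq_zero]

theorem numBlocks_expand (A : List Item) : numBlocks (expand A) = (blocks A).length := by
  rw [numBlocks]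
  induction A with
  | nil => rfl
  | cons x r ih =>
    cases x with
    | sym a => simpa [expand, blocks] using ih
    | blk b => simp [expand, blocks, List.count_append, count_op_map_sym, ih, -List.map_reverse]

theorem copyIns_map_sym_append (i : ℕ) (l : List ℕ) (r : List Tok) (bs : List ℕ)
    (p : Option ℕ) :
    copyIns i (l.map Tok.sym ++ r) bs p = (l.map (loc i)).map Tok.sym ++
      copyIns i r bs ((l.map (loc i)).getLast?.or p) := by
  induction l generalizing p with
  | nil => simp
  | cons a l ih =>
    rw [List.map_cons, List.cons_append, copyIns, ih, List.map_cons, List.map_cons,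
      List.cons_append, List.getLast?_cons]
    congr 3
    cases (l.map (loc i)).getLast? <;> simp

theorem copyIns_expand (i : ℕ) {A : List Item} (hA : ∀ b ∈ blocks A, b ≠ []) {bs : List ℕ}
    (h : bs.length = (blocks A).length) (p : Option ℕ) :
    copyIns i (expand A) bs p = expand (insertCopy i A bs) := by
  induction A generalizing bs p with
  | nil => simp [expand, insertCopy, copyIns]
  | cons x r ih =>
    cases x with
    | sym a => rw [expand, copyIns, ih hA h, insertCopy, expand]
    | blk c =>
      simp only [blocks, List.mem_cons, forall_eq_or_imp] at hA
      cases bs with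
      | nil => simp [blocks] at h
      | cons b bs =>
        obtain ⟨c, q, rfl⟩ := (List.eq_nil_or_concat' c).resolve_left hA.1
        rw [expand, List.cons_append, copyIns, copyIns_map_sym_append, insertCopy, expand,
          List.map_append, List.map_singleton, List.getLast?_concat, Option.some_or, copyIns,
          copyIns_map_sym_append, ih hA.2 (by simpa [blocks] using h)]
        simp

theorem bulletAux_map_sym_append (A : List Tok) (i : ℕ) (l : List ℕ) (r : List Tok) :
    bulletAux A i (l.map Tok.sym ++ r) = (l.map glob).map Tok.sym ++ bulletAux A i r := by
  induction l with
  | nil => rfl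
  | cons a l ih => simp [bulletAux, ih]

theorem expand_append (A B : List Item) : expand (A ++ B) = expand A ++ expand B := by
  induction A with
  | nil => rfl
  | cons x r ih => cases x <;> simp [expand, ih]

theorem expand_map_sym (l : List ℕ) : expand (l.map Item.sym) = l.map Tok.sym := by
  induction l with
  | nil => rfl
  | cons a l ih => simp [expand, ih]

theorem bulletAux_expand {A B : List Item} (hA : ∀ b ∈ blocks A, b ≠ [])
    (hpos : 1 ≤ (blocks A).length) (hB : ∀ b ∈ blocks B, b.length = (blocks A).length) (i : ℕ) :
    bulletAux (expand A) i (expand B) = expand (shuffle A i B) := by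
  induction B generalizing i with
  | nil => simp [expand, shuffle, bulletAux]
  | cons x r ih =>
    cases x with
    | sym a => rw [expand, bulletAux, ih hB, shuffle, expand]
    | blk b =>
      simp only [blocks, List.mem_cons, forall_eq_or_imp] at hB
      rw [expand, List.cons_append, bulletAux, takeBlock_map_sym, copyA,
        copyIns_expand i hA hB.1, bulletAux_map_sym_append, ih hB.2, shuffle, expand_append,
        expand_append, ← List.map_map, ← List.map_reverse, expand_map_sym]
      obtain rfl | ⟨c, q, rfl⟩ := List.eq_nil_or_concat' b
      · simp at hB
        omega
      · simp

theorem split2_expand {B : List Item} (hB : ∀ b ∈ blocks B, b.length = 2) :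
    split2 (expand B) = expand (splitBlocks B) := by
  induction B with
  | nil => simp [expand, splitBlocks, split2]
  | cons x r ih =>
    cases x with
    | sym a => simp [expand, splitBlocks, split2, ih hB]
    | blk b =>
      simp only [blocks, List.mem_cons, forall_eq_or_imp] at hB
      obtain ⟨a, b, rfl⟩ := List.length_eq_two.1 hB.1
      simp [expand, splitBlocks, split2, ih hB.2]

theorem HS_eq_expand (k m : ℕ) : HS (k + 1) (m + 1) = expand (compressedHS k m) := by
  induction k generalizing m with
  | zero =>
    have h : (List.range' 1 (m + 1)).dropLast = List.range' 1 m := by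
      rw [List.range'_1_concat, List.dropLast_concat]
    rw [HS, compressedHS, expand, expand_map_sym, h, S1, Nat.add_sub_cancel]
  | succ k ihk =>
    induction m with
    | zero =>
      rw [HS, ihk 1, compressedHS, split2_expand (wellFormed_compressedHS k 1).1.length_eq]
    | succ m ihm =>
      obtain ⟨hA, hpos, -⟩ := wellFormed_compressedHS (k + 1) m
      have hB := (wellFormed_compressedHS k ((blocks (compressedHS (k + 1) m)).length - 1)).1
      have hN := ihk ((blocks (compressedHS (k + 1) m)).length - 1)
      rw [Nat.sub_add_cancel hpos] at hB hN
      rw [HS, ihm, numBlocks_expand, hN, compressedHS, bullet]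
      refine bulletAux_expand (fun b hb h => ?_) hpos hB.length_eq 0
      simpa [h] using hA.length_eq b hb

/-! ### Structural containment from embeddings -/

theorem symsOf_expand_sublist {f ρ : ℕ → ℕ} (hρ : StrictMono ρ) {A A' : List Item}
    (h : Embeds f ρ A A') : ((symsOf (expand A)).map f).Sublist (symsOf (expand A')) := by
  induction h with
  | nil => exact List.nil_sublist _
  | cons h _ ih =>
    cases h with
    | sym a => exact ih.cons_cons _
    | blk hb =>
      have hsub := hb.sublist hρ
      rw [symsOf_expand_blk, symsOf_expand_blk, List.map_append, List.map_append]
      refine hsub.append (List.Sublist.append ?_ ih)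
      rw [List.map_reverse, List.map_dropLast, ← List.tail_reverse, ← List.tail_reverse]
      exact (List.reverse_sublist.2 hsub).tail
  | @cons_right x _ _ _ ih =>
    cases x with
    | sym a => exact ih.cons _
    | blk b =>
      rw [symsOf_expand_blk, ← List.append_assoc]
      exact ih.trans (List.sublist_append_right _ _)

theorem mem_flatten_of_mem_symsOf {n : ℕ} {A : List Item} (hA : WellFormed n A) {a : ℕ}
    (ha : a ∈ symsOf (expand A)) : a ∈ (blocks A).flatten := by
  have key : ∀ l : List Item, a ∈ symsOf (expand l) →
      Item.sym a ∈ l ∨ a ∈ (blocks l).flatten := by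
    intro l
    induction l with
    | nil => simp [expand, symsOf]
    | cons x r ih =>
      intro h
      cases x with
      | sym b =>
        rcases List.mem_cons.1 h with rfl | h
        · exact .inl (by simp)
        · exact (ih h).imp (List.mem_cons_of_mem _) id
      | blk b =>
        rw [symsOf_expand_blk, List.mem_append, List.mem_append, List.mem_reverse] at h
        rw [blocks, List.flatten_cons, List.mem_append]
        rcases h with h | h | h
        · exact .inr (.inl h)
        · exact .inr (.inl (List.mem_of_mem_dropLast h))
        · exact (ih h).imp (List.mem_cons_of_mem _) .inr
  exact (key A ha).elim (hA.covered a) id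

theorem exists_getElem?_of_mem_flatten {L : List (List ℕ)} {a : ℕ} (h : a ∈ L.flatten) :
    ∃ (i j : ℕ) (b : List ℕ), L[i]? = some b ∧ b[j]? = some a := by
  obtain ⟨b, hb, ha⟩ := List.mem_flatten.1 h
  obtain ⟨i, hi⟩ := List.mem_iff_getElem?.1 hb
  obtain ⟨j, hj⟩ := List.mem_iff_getElem?.1 ha
  exact ⟨i, j, b, hi, hj⟩

theorem index_eq_of_nodup_flatten {L : List (List ℕ)} (hL : L.flatten.Nodup) {a i i' : ℕ}
    {b b' : List ℕ} (hi : L[i]? = some b) (hi' : L[i']? = some b') (ha : a ∈ b) (ha' : a ∈ b') :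
    i = i' := by
  have hdisj := List.pairwise_iff_getElem.1 (List.nodup_flatten.1 hL).2
  obtain ⟨h, rfl⟩ := List.getElem?_eq_some_iff.1 hi
  obtain ⟨h', rfl⟩ := List.getElem?_eq_some_iff.1 hi'
  rcases lt_trichotomy i i' with hlt | heq | hgt
  · exact (hdisj i i' h h' hlt ha ha').elim
  · exact heq
  · exact (hdisj i' i h' h hgt ha' ha).elim

theorem position_eq_of_nodup {b : List ℕ} (hb : b.Nodup) {a j j' : ℕ}
    (hj : b[j]? = some a) (hj' : b[j']? = some a) : j = j' := by
  obtain ⟨h, e⟩ := List.getElem?_eq_some_iff.1 hj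
  obtain ⟨h', e'⟩ := List.getElem?_eq_some_iff.1 hj'
  exact (hb.getElem_inj_iff).1 (e.trans e'.symm)

theorem rankOf_expand {n : ℕ} {A : List Item} (hA : WellFormed n A) {a i j : ℕ} {b : List ℕ}
    (hi : (blocks A)[i]? = some b) (hj : b[j]? = some a) : rankOf (expand A) a = j + 1 := by
  rw [rankOf, blocksOf_expand]
  have hmem : a ∈ b := List.mem_of_getElem? hj
  cases hfind : (blocks A).find? fun b => decide (a ∈ b) with
  | none =>
    have := List.find?_eq_none.1 hfind b (List.mem_of_getElem? hi)
    simp [hmem] at this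
  | some c =>
    have hac : a ∈ c := by simpa using List.find?_some hfind
    obtain ⟨i', hi'⟩ := List.mem_iff_getElem?.1 (List.mem_of_find?_eq_some hfind)
    obtain rfl := index_eq_of_nodup_flatten hA.nodup hi hi' hmem hac
    obtain rfl : b = c := by simpa [hi] using hi'
    have hnd := (List.nodup_flatten.1 hA.nodup).1 b (List.mem_of_getElem? hi)
    exact congrArg (· + 1) (position_eq_of_nodup hnd (List.getElem?_idxOf hmem) hj)

theorem exists_strictMono_blockRepresents {f ρ : ℕ → ℕ} {A A' : List Item}
    (h : Embeds f ρ A A') :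
    ∃ s : ℕ → ℕ, StrictMono s ∧ ∀ i b, (blocks A)[i]? = some b →
      ∃ b', (blocks A')[s i]? = some b' ∧ BlockRepresents f ρ b b' := by
  induction h with
  | nil => exact ⟨id, strictMono_id, by simp [blocks]⟩
  | cons h _ ih =>
    obtain ⟨s, hs, hrep⟩ := ih
    cases h with
    | sym a => exact ⟨s, hs, hrep⟩
    | @blk c c' hc =>
      refine ⟨fun j => j.casesOn 0 fun j => s j + 1, ?_, fun i b hi => ?_⟩
      · refine strictMono_nat_of_lt_succ fun j => ?_
        cases j with
        | zero => simp
        | succ j => simpa using hs (Nat.lt_succ_self j)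
      · cases i with
        | zero =>
          obtain rfl : c = b := by simpa [blocks] using hi
          exact ⟨c', rfl, hc⟩
        | succ i => simpa [blocks] using hrep i b (by simpa [blocks] using hi)
  | @cons_right x _ _ _ ih =>
    obtain ⟨s, hs, hrep⟩ := ih
    cases x with
    | sym a => exact ⟨s, hs, hrep⟩
    | blk c =>
      exact ⟨fun j => s j + 1, fun a b hab => Nat.succ_lt_succ (hs hab),
        fun i b hi => by simpa [blocks] using hrep i b hi⟩

theorem structurally_contains_of_embeds {f ρ : ℕ → ℕ} (hρ : StrictMono ρ) {n n' : ℕ}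
    {A A' : List Item} (hA : WellFormed n A) (hA' : WellFormed n' A') (h : Embeds f ρ A A') :
    Set.InjOn f {a | a ∈ symsOf (expand A)} ∧
      ((symsOf (expand A)).map f).Sublist (symsOf (expand A')) ∧
      (∀ a ∈ symsOf (expand A), ∀ b ∈ symsOf (expand A),
        (SameBlock (expand A') (f a) (f b) ↔ SameBlock (expand A) a b)) ∧
      (∀ a ∈ symsOf (expand A), ∃ j < n,
        rankOf (expand A) a = j + 1 ∧ rankOf (expand A') (f a) = ρ j + 1) := by
  obtain ⟨s, hs, hrep⟩ := exists_strictMono_blockRepresents h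
  have hpos : ∀ a ∈ symsOf (expand A), ∃ (i j : ℕ) (b b' : List ℕ), (blocks A)[i]? = some b ∧
      b[j]? = some a ∧ (blocks A')[s i]? = some b' ∧ b'[ρ j]? = some (f a) := by
    intro a ha
    obtain ⟨i, j, b, hi, hj⟩ :=
      exists_getElem?_of_mem_flatten (mem_flatten_of_mem_symsOf hA ha)
    obtain ⟨b', hi', hb'⟩ := hrep i b hi
    exact ⟨i, j, b, b', hi, hj, hi', hb' j a hj⟩
  refine ⟨fun a ha c hc hac => ?_, symsOf_expand_sublist hρ h, fun a ha c hc => ?_,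
    fun a ha => ?_⟩
  · obtain ⟨i, j, b, b', hi, hj, hi', hj'⟩ := hpos a ha
    obtain ⟨i₂, j₂, b₂, b₂', hi₂, hj₂, hi₂', hj₂'⟩ := hpos c hc
    rw [← hac] at hj₂'
    obtain rfl := hs.injective (index_eq_of_nodup_flatten hA'.nodup hi' hi₂'
      (List.mem_of_getElem? hj') (List.mem_of_getElem? hj₂'))
    obtain rfl : b = b₂ := by simpa [hi] using hi₂
    obtain rfl : b' = b₂' := by simpa [hi'] using hi₂'
    have hnd := (List.nodup_flatten.1 hA'.nodup).1 b' (List.mem_of_getElem? hi')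
    obtain rfl := hρ.injective (position_eq_of_nodup hnd hj' hj₂')
    simpa [hj] using hj₂
  · obtain ⟨i, j, b, b', hi, hj, hi', hj'⟩ := hpos a ha
    obtain ⟨i₂, j₂, b₂, b₂', hi₂, hj₂, hi₂', hj₂'⟩ := hpos c hc
    simp only [SameBlock, blocksOf_expand]
    constructor
    · rintro ⟨d, hd, had, hcd⟩
      obtain ⟨p, hp⟩ := List.mem_iff_getElem?.1 hd
      have h₁ := index_eq_of_nodup_flatten hA'.nodup hi' hp (List.mem_of_getElem? hj') had
      have h₂ := index_eq_of_nodup_flatten hA'.nodup hi₂' hp (List.mem_of_getElem? hj₂') hcd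
      obtain rfl := hs.injective (h₁.trans h₂.symm)
      obtain rfl : b = b₂ := by simpa [hi] using hi₂
      exact ⟨b, List.mem_of_getElem? hi, List.mem_of_getElem? hj, List.mem_of_getElem? hj₂⟩
    · rintro ⟨d, hd, had, hcd⟩
      obtain ⟨p, hp⟩ := List.mem_iff_getElem?.1 hd
      obtain rfl := index_eq_of_nodup_flatten hA.nodup hi hp (List.mem_of_getElem? hj) had
      obtain rfl := index_eq_of_nodup_flatten hA.nodup hi₂ hp (List.mem_of_getElem? hj₂) hcd
      obtain rfl : b' = b₂' := by simpa [hi'] using hi₂'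
      exact ⟨b', List.mem_of_getElem? hi', List.mem_of_getElem? hj', List.mem_of_getElem? hj₂'⟩
  · obtain ⟨i, j, b, b', hi, hj, hi', hj'⟩ := hpos a ha
    refine ⟨j, ?_, rankOf_expand hA hi hj, rankOf_expand hA' hi' hj'⟩
    rw [← hA.length_eq b (List.mem_of_getElem? hi)]
    exact (List.getElem?_eq_some_iff.1 hj).1

/-- A choice of ranks extends to a strictly increasing choice of positions. -/
theorem exists_strictMono_extension {m : ℕ} {r : ℕ → ℕ}
    (hr : ∀ j, 1 ≤ j → j < m + 1 → r j < r (j + 1)) (hr1 : 1 ≤ r 1) :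
    ∃ ρ : ℕ → ℕ, StrictMono ρ ∧ ∀ j ≤ m, ρ j + 1 = r (j + 1) := by
  have hpos : ∀ j ≤ m, 1 ≤ r (j + 1) := by
    intro j
    induction j with
    | zero => exact fun _ => hr1
    | succ j ih =>
      intro hj
      have := hr (j + 1) (by omega) (by omega)
      omega
  refine ⟨fun j => r (min j m + 1) - 1 + (j - m), strictMono_nat_of_lt_succ fun j => ?_,
    fun j hj => ?_⟩
  · rcases lt_or_ge j m with hj | hj
    · have h₁ := hr (j + 1) (by omega) (by omega)
      have h₂ := hpos j hj.le
      rw [min_eq_left hj.le, min_eq_left (show j + 1 ≤ m from hj)]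
      omega
    · rw [min_eq_right hj, min_eq_right (by omega)]
      omega
  · have := hpos j hj
    simp only [min_eq_left hj]
    omega

end HartSharir

/-- Lemma `lem_structurally`: for every `k′ ≥ k ≥ 1`, `m′ ≥ m ≥ 1`, and every
choice of `m` ranks `1 ≤ r 1 < r 2 < ⋯ < r m ≤ m′`, the Hart–Sharir sequence
`S_{k′}(m′)` structurally contains `S_k(m)` by a copy (given by an injective
renaming `f` of the symbols) in which two symbols lie in the same special block if
and only if the corresponding symbols of `S_k(m)` do, and in which every symbol of
rank `j` in `S_k(m)` is represented by a symbol of rank `r j` in `S_{k′}(m′)`. -/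
theorem lem_structurally (k k' m m' : ℕ) (r : ℕ → ℕ)
    (hk : 1 ≤ k) (hkk' : k ≤ k') (hm : 1 ≤ m) (hmm' : m ≤ m')
    (hrmono : ∀ j, 1 ≤ j → j < m → r j < r (j + 1))
    (hr1 : 1 ≤ r 1) (hrm : r m ≤ m') :
    ∃ f : ℕ → ℕ,
      Set.InjOn f {a | a ∈ symsOf (HS k m)} ∧
      ((symsOf (HS k m)).map f).Sublist (symsOf (HS k' m')) ∧
      (∀ a ∈ symsOf (HS k m), ∀ b ∈ symsOf (HS k m),
        (SameBlock (HS k' m') (f a) (f b) ↔ SameBlock (HS k m) a b)) ∧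
      (∀ a ∈ symsOf (HS k m), rankOf (HS k' m') (f a) = r (rankOf (HS k m) a)) := by
  obtain ⟨k, rfl⟩ := Nat.exists_eq_add_of_le' hk
  obtain ⟨k', rfl⟩ := Nat.exists_eq_add_of_le' (hk.trans hkk')
  obtain ⟨m, rfl⟩ := Nat.exists_eq_add_of_le' hm
  obtain ⟨m', rfl⟩ := Nat.exists_eq_add_of_le' (hm.trans hmm')
  obtain ⟨ρ, hρ, hρr⟩ := HartSharir.exists_strictMono_extension hrmono hr1
  obtain ⟨f, hf⟩ := HartSharir.exists_embeds_compressedHS k' m' k m ρ (by omega) hρ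
    (by have := hρr m le_rfl; omega)
  obtain ⟨hinj, hsub, hsame, hrank⟩ := HartSharir.structurally_contains_of_embeds hρ
    (HartSharir.wellFormed_compressedHS k m).1 (HartSharir.wellFormed_compressedHS k' m').1 hf
  simp only [HartSharir.HS_eq_expand]
  refine ⟨f, hinj, hsub, hsame, fun a ha => ?_⟩
  obtain ⟨j, hj, h₁, h₂⟩ := hrank a ha
  rw [h₁, h₂, hρr j (by omega)]
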